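/- Let G be a candidate, let C be a shortest long even hole in G, and let x, y be nonadjacent C-major vertices. Let P be a (C,x)-gap of length at least ℓ−2 with ends p1, p2. If y has a neighbour in V(P), then at least one of the following holds: (i) for some i ∈ {1,2}, some neighbour v of y in V(P) satisfies d_P(p_i, v) ≤ ℓ−5; (ii) for some i ∈ {1,2}, y is adjacent to a neighbour of p_i in C; (iii) y has exactly two neighbours in V(P) and they are adjacent. -/

import Mathlib

open SimpleGraph

namespace LEH

open scoped Classical

variable {V : Type*}

/-- `X` is anticomplete to `Y`: they are disjoint and there are no edges between them. -/
def Anticomplete (G : SimpleGraph V) (X Y : Set V) : Prop :=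
  ∀ ⦃x⦄, x ∈ X → ∀ ⦃y⦄, y ∈ Y → x ≠ y ∧ ¬ G.Adj x y

/-- The vertex set of a walk. -/
def vset {G : SimpleGraph V} {u v : V} (P : G.Walk u v) : Set V :=
  {x | x ∈ P.support}

/-- The interior of a path: its non-end vertices. -/
def inter {G : SimpleGraph V} {u v : V} (P : G.Walk u v) : Set V :=
  {x | x ∈ P.support ∧ x ≠ u ∧ x ≠ v}

/-- An induced path in `G`. -/
def IsInducedPath {G : SimpleGraph V} {u v : V} (P : G.Walk u v) : Prop :=
  P.IsPath ∧ ∀ x ∈ P.support, ∀ y ∈ P.support, G.Adj x y → s(x, y) ∈ P.edges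

/-- A hole: an induced cycle of length at least 4. -/
def IsHole {G : SimpleGraph V} {u : V} (c : G.Walk u u) : Prop :=
  c.IsCycle ∧ 4 ≤ c.length ∧
    ∀ x ∈ c.support, ∀ y ∈ c.support, G.Adj x y → s(x, y) ∈ c.edges

/-- A long even hole: a hole of even length at least `ℓ`. -/
def IsLongEvenHole (ℓ : ℕ) {G : SimpleGraph V} {u : V} (c : G.Walk u u) : Prop :=
  IsHole c ∧ ℓ ≤ c.length ∧ Even c.length

def HasLongEvenHole (G : SimpleGraph V) (ℓ : ℕ) : Prop :=
  ∃ (u : V) (c : G.Walk u u), IsLongEvenHole ℓ c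

/-- A long theta in `G`: two nonadjacent vertices joined by three internally disjoint
induced paths with no edges between their interiors, any two of which form a long hole. -/
def HasLongTheta (G : SimpleGraph V) (ℓ : ℕ) : Prop :=
  ∃ (u v : V) (P₁ P₂ P₃ : G.Walk u v),
    u ≠ v ∧ ¬ G.Adj u v ∧
    IsInducedPath P₁ ∧ IsInducedPath P₂ ∧ IsInducedPath P₃ ∧
    Anticomplete G (inter P₁) (inter P₂) ∧
    Anticomplete G (inter P₁) (inter P₃) ∧
    Anticomplete G (inter P₂) (inter P₃) ∧
    ℓ ≤ P₁.length + P₂.length ∧ ℓ ≤ P₁.length + P₃.length ∧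
    ℓ ≤ P₂.length + P₃.length

/-- A long jewel of order `k` formed by `Q₁, Q₂, P`. -/
def IsLongJewel (ℓ k : ℕ) {G : SimpleGraph V} {u v : V}
    (Q₁ Q₂ P : G.Walk u v) : Prop :=
  u ≠ v ∧
  IsInducedPath Q₁ ∧ IsInducedPath Q₂ ∧ IsInducedPath P ∧
  ¬ (Even Q₁.length ↔ Even Q₂.length) ∧
  max Q₁.support.length Q₂.support.length = k ∧
  ℓ ≤ P.length + min Q₁.length Q₂.length ∧
  Anticomplete G (inter P) (inter Q₁ ∪ inter Q₂)

def HasLongJewel (G : SimpleGraph V) (ℓ k : ℕ) : Prop :=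
  ∃ (u v : V) (Q₁ Q₂ P : G.Walk u v), IsLongJewel ℓ k Q₁ Q₂ P

/-- A long ban-the-bomb in `G`. -/
def IsLongBanTheBomb (ℓ : ℕ) {G : SimpleGraph V} (u v₁ w v₂ x : V)
    (P₁ : G.Walk x v₁) (P₂ : G.Walk x v₂) : Prop :=
  G.Adj u v₁ ∧ G.Adj v₁ w ∧ G.Adj w v₂ ∧ G.Adj v₂ u ∧ ¬ G.Adj v₁ v₂ ∧ u ≠ w ∧
  G.Adj x u ∧ ¬ G.Adj x v₁ ∧ ¬ G.Adj x v₂ ∧ ¬ G.Adj x w ∧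
  x ≠ v₁ ∧ x ≠ v₂ ∧ x ≠ w ∧
  IsInducedPath P₁ ∧ IsInducedPath P₂ ∧
  2 ≤ P₁.length ∧ 2 ≤ P₂.length ∧
  Anticomplete G (inter P₁) {u, w} ∧ Anticomplete G (inter P₂) {u, w} ∧
  Anticomplete G (vset P₁ \ {x}) (vset P₂ \ {x}) ∧
  ℓ ≤ P₁.length + 2 ∧ ℓ ≤ P₂.length + 2 ∧ ℓ ≤ P₁.length + P₂.length + 2

def HasLongBanTheBomb (G : SimpleGraph V) (ℓ : ℕ) : Prop :=
  ∃ (u v₁ w v₂ x : V) (P₁ : G.Walk x v₁) (P₂ : G.Walk x v₂),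
    IsLongBanTheBomb ℓ u v₁ w v₂ x P₁ P₂

/-- The induced subgraph of `G` on the vertex set `S` is a long hole. -/
def IsLongHoleOn (G : SimpleGraph V) (ℓ : ℕ) (S : Set V) : Prop :=
  ∃ (u : V) (c : G.Walk u u), IsHole c ∧ ℓ ≤ c.length ∧ {x | x ∈ c.support} = S

/-- A long near-prism with triangles `{a 0, a 1, a 2}`, `{b 0, b 1, b 2}` and
constituent paths `P 0, P 1, P 2`. -/
def IsLongNearPrism (ℓ : ℕ) {G : SimpleGraph V} (a b : Fin 3 → V)
    (P : ∀ i : Fin 3, G.Walk (a i) (b i)) : Prop :=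
  (∀ i j, i ≠ j → G.Adj (a i) (a j)) ∧
  (∀ i j, i ≠ j → G.Adj (b i) (b j)) ∧
  (Set.range a ∩ Set.range b).Subsingleton ∧
  (∀ i, (P i).IsPath) ∧
  (∀ i j, i ≠ j → ∀ x, x ∈ (P i).support → x ∉ (P j).support) ∧
  (∀ i j, i ≠ j → IsLongHoleOn G ℓ (vset (P i) ∪ vset (P j)))

def HasLongNearPrism (G : SimpleGraph V) (ℓ : ℕ) : Prop :=
  ∃ (a b : Fin 3 → V) (P : ∀ i : Fin 3, G.Walk (a i) (b i)), IsLongNearPrism ℓ a b P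

/-- A prospect: no long even hole of length at most `2ℓ`, no long jewel of order at most
`ℓ+1`, no long theta and no long ban-the-bomb. -/
def Prospect (G : SimpleGraph V) (ℓ : ℕ) : Prop :=
  (¬ ∃ (u : V) (c : G.Walk u u), IsLongEvenHole ℓ c ∧ c.length ≤ 2 * ℓ) ∧
  (¬ ∃ k ≤ ℓ + 1, HasLongJewel G ℓ k) ∧
  ¬ HasLongTheta G ℓ ∧ ¬ HasLongBanTheBomb G ℓ

/-- A candidate : a prospect with no long near-prism. -/
def Candidate (G : SimpleGraph V) (ℓ : ℕ) : Prop :=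
  Prospect G ℓ ∧ ¬ HasLongNearPrism G ℓ

/-- The vertex set of a near-prism. -/
def prismSupport {G : SimpleGraph V} {a b : Fin 3 → V}
    (P : ∀ i : Fin 3, G.Walk (a i) (b i)) : Set V :=
  ⋃ i, vset (P i)

/-- The near-prism, as a graph on `V`. -/
def prismGraph (G : SimpleGraph V) (a b : Fin 3 → V)
    (P : ∀ i : Fin 3, G.Walk (a i) (b i)) : SimpleGraph V :=
  SimpleGraph.fromEdgeSet
    ({e | ∃ i j, i ≠ j ∧ e = s(a i, a j)} ∪ {e | ∃ i j, i ≠ j ∧ e = s(b i, b j)} ∪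
      {e | ∃ i, e ∈ (P i).edges})

/-- `q` is `K`-major: `q` is outside the near-prism `K`, and no path of `K` with at most
three vertices contains all neighbours of `q` in `V(K)`. -/
def KMajor (G : SimpleGraph V) {a b : Fin 3 → V}
    (P : ∀ i : Fin 3, G.Walk (a i) (b i)) (q : V) : Prop :=
  q ∉ prismSupport P ∧
  ¬ ∃ (x y : V) (W : (prismGraph G a b P).Walk x y), W.IsPath ∧ W.length ≤ 2 ∧
      ∀ z ∈ prismSupport P, G.Adj q z → z ∈ W.support

/-- A shortest long near-prism. -/
def ShortestLNP (G : SimpleGraph V) (ℓ : ℕ) {a b : Fin 3 → V}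
    (P : ∀ i : Fin 3, G.Walk (a i) (b i)) : Prop :=
  IsLongNearPrism ℓ a b P ∧
  ∀ (a' b' : Fin 3 → V) (P' : ∀ i : Fin 3, G.Walk (a' i) (b' i)),
    IsLongNearPrism ℓ a' b' P' → (prismSupport P).ncard ≤ (prismSupport P').ncard

/-- The interior `F_K*` of the frame of a long near-prism: for each constituent path,
either the whole path (if it has length at most `ℓ-1`), or the non-end vertices of the
two stubs of length `ℓ/2 - 1` at its two ends. -/
def frameStar (ℓ : ℕ) {G : SimpleGraph V} {a b : Fin 3 → V}
    (P : ∀ i : Fin 3, G.Walk (a i) (b i)) : Set V :=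
  ⋃ i,
    if (P i).length ≤ ℓ - 1 then vset (P i)
    else {x | x ∈ (P i).support.take (ℓ / 2 - 1)} ∪
      {x | x ∈ (P i).support.reverse.take (ℓ / 2 - 1)}

/-- A long near-prism is tidy: it contains a frame (so at most one constituent path has
length at most `ℓ-1`) whose interior is anticomplete to the rest of the graph. -/
def Tidy (G : SimpleGraph V) (ℓ : ℕ) {a b : Fin 3 → V}
    (P : ∀ i : Fin 3, G.Walk (a i) (b i)) : Prop :=
  (∀ i j, (P i).length ≤ ℓ - 1 → (P j).length ≤ ℓ - 1 → i = j) ∧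
  Anticomplete G (frameStar ℓ P) {x | x ∉ prismSupport P}

/-- The index of the first neighbour of `x` in the list `l`. -/
noncomputable def firstNbrIdx (G : SimpleGraph V) (l : List V) (x : V) : ℕ :=
  l.findIdx (fun y => decide (G.Adj x y))

/-- `α(x)`: the neighbour of `x` on `P` nearest to the first end of `P`. -/
noncomputable def alpha (G : SimpleGraph V) {u w : V} (P : G.Walk u w) (x : V) : V :=
  P.support.getD (firstNbrIdx G P.support x) u

/-- `β(x)`: the neighbour of `x` on `P` nearest to the last end of `P`. -/
noncomputable def beta (G : SimpleGraph V) {u w : V} (P : G.Walk u w) (x : V) : V :=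
  P.support.reverse.getD (firstNbrIdx G P.support.reverse x) w

/-- `A(x)`: the vertex set of the subpath of `P` from its first end to `α(x)` if `x` has
a neighbour on `P`, and all of `V(P)` otherwise. -/
noncomputable def Aset (G : SimpleGraph V) {u w : V} (P : G.Walk u w) (x : V) : Set V :=
  if ∃ y ∈ P.support, G.Adj x y then
    {z | z ∈ P.support.take (firstNbrIdx G P.support x + 1)}
  else vset P

noncomputable def A123 (G : SimpleGraph V) {a b : Fin 3 → V}
    (P : ∀ i : Fin 3, G.Walk (a i) (b i)) (x : V) : Set V :=
  ⋃ i, Aset G (P i) x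

/-- The index of `v` in the list `l`. -/
noncomputable def listIdx (l : List V) (v : V) : ℕ :=
  l.findIdx (fun z => decide (z = v))

/-- `K^m_n(v)`: the union of the maximal subpath of `P` from `v` towards the first end of
`P` of length at most `m` with no internal vertex in `Fs`, and the maximal subpath of `P`
from `v` towards the last end of `P` of length at most `n` with no internal vertex in `Fs`. -/
noncomputable def Kmn (G : SimpleGraph V) (Fs : Set V) {u w : V}
    (P : G.Walk u w) (v : V) (m n : ℕ) : Set V :=
  let t := listIdx P.support v
  {z | ∃ r, r ≤ t ∧ t - r ≤ m ∧
      (∀ q, r < q → q < t → P.support.getD q v ∉ Fs) ∧ z = P.support.getD r v} ∪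
  {z | ∃ r, t ≤ r ∧ r < P.support.length ∧ r - t ≤ n ∧
      (∀ q, t < q → q < r → P.support.getD q v ∉ Fs) ∧ z = P.support.getD r v}

/-- `y` is distant from `x` (both `K`-major), for a tidy near-prism. -/
def Distant (G : SimpleGraph V) (ℓ : ℕ) {a b : Fin 3 → V}
    (P : ∀ i : Fin 3, G.Walk (a i) (b i)) (x y : V) : Prop :=
  ¬ G.Adj x y ∧
  (∃ z ∈ A123 G P x, G.Adj y z) ∧
  (∀ i, (∃ z ∈ (P i).support, G.Adj x z) →
    ∀ z ∈ Kmn G (frameStar ℓ P) (P i) (alpha G (P i) x) (ℓ - 2) 1, ¬ G.Adj y z) ∧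
  (∀ i, (¬ ∃ z ∈ (P i).support, G.Adj x z) →
    ∃ j, j ≠ i ∧
      ∀ z ∈ Kmn G (frameStar ℓ P) (P j) (beta G (P j) x) 0 (ℓ - 3), ¬ G.Adj y z)

/-- The hole `c`, regarded as a graph on `V`. -/
def holeGraph (G : SimpleGraph V) {u : V} (c : G.Walk u u) : SimpleGraph V :=
  SimpleGraph.fromEdgeSet {e | e ∈ c.edges}

/-- The distance between two vertices in the hole `c`. -/
noncomputable def holeDist (G : SimpleGraph V) {u : V} (c : G.Walk u u) (x y : V) : ℕ :=
  (holeGraph G c).dist x y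

/-- `x` is `C`-major for the hole `c`: `x` is not on `c` and no path of `c` with at most
three vertices contains all neighbours of `x` on `c`. -/
def CMajor (G : SimpleGraph V) {u : V} (c : G.Walk u u) (x : V) : Prop :=
  x ∉ c.support ∧
  ¬ ∃ q ∈ c.support, ∀ z ∈ c.support, G.Adj x z → z = q ∨ s(q, z) ∈ c.edges

/-- A shortest long even hole. -/
def ShortestLEH (G : SimpleGraph V) (ℓ : ℕ) {u : V} (c : G.Walk u u) : Prop :=
  IsLongEvenHole ℓ c ∧
  ∀ (v : V) (c' : G.Walk v v), IsLongEvenHole ℓ c' → c.length ≤ c'.length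

/-- `L₁, L₂` are the two `x y`-paths of the hole `c`. -/
def ArcPair {G : SimpleGraph V} {u : V} (c : G.Walk u u) {x y : V}
    (L₁ L₂ : G.Walk x y) : Prop :=
  L₁.IsPath ∧ L₂.IsPath ∧
  (∀ e ∈ L₁.edges, e ∈ c.edges) ∧ (∀ e ∈ L₂.edges, e ∈ c.edges) ∧
  (∀ e ∈ c.edges, e ∈ L₁.edges ∨ e ∈ L₂.edges) ∧
  (∀ e ∈ L₁.edges, e ∉ L₂.edges)

/-- `X` is lighter than `Y`, with respect to the linear order on edges given by `idx`. -/
def Lighter [DecidableEq V] (idx : Sym2 V → ℕ) (X Y : Finset (Sym2 V)) : Prop :=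
  X.card < Y.card ∨
  (X.card = Y.card ∧ ∃ e ∈ Y, e ∉ X ∧
    ∀ f : Sym2 V, ((f ∈ X ∧ f ∉ Y) ∨ (f ∈ Y ∧ f ∉ X)) → idx e ≤ idx f)

/-- The lightest long even hole. -/
def LightestLEH [DecidableEq V] (G : SimpleGraph V) (ℓ : ℕ) (idx : Sym2 V → ℕ)
    {u : V} (c : G.Walk u u) : Prop :=
  IsLongEvenHole ℓ c ∧
  ∀ (v : V) (c' : G.Walk v v), IsLongEvenHole ℓ c' →
    c'.edges.toFinset ≠ c.edges.toFinset →
    Lighter idx c.edges.toFinset c'.edges.toFinset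

/-- A `(C,x)`-gap: a path of the hole `c` of length at least two whose ends are adjacent
to `x` and none of whose interior vertices is adjacent to `x`. -/
def IsGap (G : SimpleGraph V) {u : V} (c : G.Walk u u) (x : V) {p₁ p₂ : V}
    (P : G.Walk p₁ p₂) : Prop :=
  P.IsPath ∧ (∀ e ∈ P.edges, e ∈ c.edges) ∧ 2 ≤ P.length ∧
  G.Adj x p₁ ∧ G.Adj x p₂ ∧ ∀ z ∈ inter P, ¬ G.Adj x z

end LEH

open LEH

namespace LEH

/-- The vertices `g 0, …, g k` form an induced path, in this order. -/
def IPath (G : SimpleGraph V) (k : ℕ) (g : ℕ → V) : Prop :=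
  ∀ i j, i < j → j ≤ k → g i ≠ g j ∧ (G.Adj (g i) (g j) ↔ j = i + 1)

/-- The vertices `f 0, …, f (n - 1)` form an induced cycle, in this order. -/
def ICyc (G : SimpleGraph V) (n : ℕ) (f : ℕ → V) : Prop :=
  ∀ i j, i < j → j < n → f i ≠ f j ∧ (G.Adj (f i) (f j) ↔ j = i + 1 ∨ (i = 0 ∧ j + 1 = n))

variable {G : SimpleGraph V} {ℓ : ℕ}

lemma mem_edges_iff_getVert {u v : V} (W : G.Walk u v) (e : Sym2 V) :
    e ∈ W.edges ↔ ∃ i < W.length, e = s(W.getVert i, W.getVert (i + 1)) := by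
  induction W with
  | nil => simp
  | cons h W ih =>
    simp only [Walk.edges_cons, List.mem_cons, ih, Walk.length_cons]
    constructor
    · rintro (rfl | ⟨i, hi, rfl⟩)
      · exact ⟨0, by omega, by simp⟩
      · exact ⟨i + 1, by omega, by simp⟩
    · rintro ⟨i, hi, rfl⟩
      rcases i with _ | i
      · left; simp
      · right; exact ⟨i, by omega, by simp⟩

lemma IPath.walk {k : ℕ} {g : ℕ → V} (hg : IPath G k g) :
    ∃ W : G.Walk (g 0) (g k), W.length = k ∧ ∀ i ≤ k, W.getVert i = g i := by
  induction k generalizing g with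
  | zero => exact ⟨Walk.nil, rfl, by simp⟩
  | succ k ih =>
    obtain ⟨W, hl, hW⟩ := @ih (fun i => g (i + 1)) (fun i j hij hj => by
      have := hg (i + 1) (j + 1) (by omega) (by omega)
      simpa using this)
    have h01 : G.Adj (g 0) (g (0 + 1)) := (hg 0 1 (by omega) (by omega)).2.2 rfl
    refine ⟨Walk.cons h01 W, by simp [hl], fun i hi => ?_⟩
    rcases i with _ | i
    · simp
    · simpa using hW i (by omega)

lemma IPath.adj_iff {k : ℕ} {g : ℕ → V} (hg : IPath G k g) {i j : ℕ} (hi : i ≤ k) (hj : j ≤ k) :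
    G.Adj (g i) (g j) ↔ j = i + 1 ∨ i = j + 1 := by
  rcases lt_trichotomy i j with h | h | h
  · rw [(hg i j h hj).2]; omega
  · subst h; simp
  · rw [G.adj_comm, (hg j i h hi).2]; omega

lemma IPath.inj {k : ℕ} {g : ℕ → V} (hg : IPath G k g) {i j : ℕ} (hi : i ≤ k) (hj : j ≤ k) :
    g i = g j ↔ i = j := by
  constructor
  · intro he
    rcases lt_trichotomy i j with h | h | h
    · exact absurd he (hg i j h hj).1
    · exact h
    · exact absurd he.symm (hg j i h hi).1
  · rintro rfl; rfl

lemma IPath.inducedPath {k : ℕ} {g : ℕ → V} (hg : IPath G k g) :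
    ∃ W : G.Walk (g 0) (g k), IsInducedPath W ∧ W.length = k ∧
      (∀ z, z ∈ W.support ↔ ∃ i ≤ k, z = g i) ∧
      ∀ e, e ∈ W.edges ↔ ∃ i < k, e = s(g i, g (i + 1)) := by
  obtain ⟨W, hl, hW⟩ := hg.walk
  have hs : ∀ z, z ∈ W.support ↔ ∃ i ≤ k, z = g i := by
    intro z
    rw [Walk.mem_support_iff_exists_getVert]
    constructor
    · rintro ⟨i, rfl, hi⟩
      exact ⟨i, by omega, hW i (by omega)⟩
    · rintro ⟨i, hi, rfl⟩
      exact ⟨i, hW i hi, by omega⟩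
  have he : ∀ e, e ∈ W.edges ↔ ∃ i < k, e = s(g i, g (i + 1)) := by
    intro e
    rw [mem_edges_iff_getVert, hl]
    constructor
    · rintro ⟨i, hi, rfl⟩
      exact ⟨i, hi, by rw [hW i (by omega), hW (i + 1) (by omega)]⟩
    · rintro ⟨i, hi, rfl⟩
      exact ⟨i, hi, by rw [hW i (by omega), hW (i + 1) (by omega)]⟩
  refine ⟨W, ⟨?_, ?_⟩, hl, hs, he⟩
  · rw [← Walk.IsPath.getVert_injOn_iff]
    intro i hi j hj hij
    simp only [Set.mem_ofPred_eq, hl] at hi hj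
    rw [hW i hi, hW j hj] at hij
    exact (hg.inj hi hj).1 hij
  · intro a ha b hb hab
    obtain ⟨i, hi, rfl⟩ := (hs a).1 ha
    obtain ⟨j, hj, rfl⟩ := (hs b).1 hb
    rw [he]
    rcases (hg.adj_iff hi hj).1 hab with h | h
    · subst h; exact ⟨i, by omega, rfl⟩
    · subst h; exact ⟨j, by omega, Sym2.eq_swap⟩

lemma mem_inter_iff {k : ℕ} {g : ℕ → V} (hg : IPath G k g) {W : G.Walk (g 0) (g k)}
    (hs : ∀ z, z ∈ W.support ↔ ∃ i ≤ k, z = g i) (z : V) :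
    z ∈ inter W ↔ ∃ i, 0 < i ∧ i < k ∧ z = g i := by
  simp only [inter, Set.mem_ofPred_eq, hs]
  constructor
  · rintro ⟨⟨i, hi, rfl⟩, h0, hk⟩
    have h0 : i ≠ 0 := by rintro rfl; exact h0 rfl
    have hk : i ≠ k := by rintro rfl; exact hk rfl
    exact ⟨i, by omega, by omega, rfl⟩
  · rintro ⟨i, h0, hk, rfl⟩
    refine ⟨⟨i, by omega, rfl⟩, ?_, ?_⟩
    · rw [Ne, hg.inj (by omega) (by omega)]; omega
    · rw [Ne, hg.inj (by omega) (by omega)]; omega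

lemma ICyc.hole {n : ℕ} {f : ℕ → V} (hn : 4 ≤ n) (hf : ICyc G n f) :
    ∃ (v : V) (c : G.Walk v v), IsHole c ∧ c.length = n ∧
      ∀ z, z ∈ c.support ↔ ∃ i < n, z = f i := by
  obtain ⟨n, rfl⟩ : ∃ m, n = m + 1 := ⟨n - 1, by omega⟩
  have hadj : ∀ i j, i < n + 1 → j < n + 1 → (G.Adj (f i) (f j) ↔
      j = i + 1 ∨ i = j + 1 ∨ (i = 0 ∧ j = n) ∨ (j = 0 ∧ i = n)) := by
    intro i j hi hj
    rcases lt_trichotomy i j with h | h | h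
    · rw [(hf i j h hj).2]; omega
    · subst h; simp only [SimpleGraph.irrefl, false_iff]; omega
    · rw [G.adj_comm, (hf j i h hi).2]; omega
  have hinj : ∀ i j, i < n + 1 → j < n + 1 → f i = f j → i = j := by
    intro i j hi hj he
    rcases lt_trichotomy i j with h | h | h
    · exact absurd he (hf i j h hj).1
    · exact h
    · exact absurd he.symm (hf j i h hi).1
  have key : ∀ m ≤ n, ∃ W : G.Walk (f 0) (f m), W.length = m ∧ ∀ i ≤ m, W.getVert i = f i := by
    intro m hm
    induction m with
    | zero => exact ⟨Walk.nil, rfl, by simp⟩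
    | succ m ih =>
      obtain ⟨W, hl, hW⟩ := ih (by omega)
      have h : G.Adj (f m) (f (m + 1)) := (hadj _ _ (by omega) (by omega)).2 (by omega)
      refine ⟨W.concat h, by simp [hl], fun i hi => ?_⟩
      rw [Walk.concat_eq_append, Walk.getVert_append]
      split_ifs with h1
      · exact hW i (by omega)
      · have : i = m ∨ i = m + 1 := by omega
        rcases this with rfl | rfl <;> simp [hl]
  obtain ⟨W, hl, hW⟩ := key n le_rfl
  have hs : ∀ z, z ∈ W.support ↔ ∃ i < n + 1, z = f i := by
    intro z
    rw [Walk.mem_support_iff_exists_getVert]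
    constructor
    · rintro ⟨i, rfl, hi⟩
      exact ⟨i, by omega, hW i (by omega)⟩
    · rintro ⟨i, hi, rfl⟩
      exact ⟨i, hW i (by omega), by omega⟩
  have he : ∀ e, e ∈ W.edges ↔ ∃ i < n, e = s(f i, f (i + 1)) := by
    intro e
    rw [mem_edges_iff_getVert, hl]
    constructor
    · rintro ⟨i, hi, rfl⟩
      exact ⟨i, hi, by rw [hW i (by omega), hW (i + 1) (by omega)]⟩
    · rintro ⟨i, hi, rfl⟩
      exact ⟨i, hi, by rw [hW i (by omega), hW (i + 1) (by omega)]⟩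
  have hcl : G.Adj (f n) (f 0) := (hadj _ _ (by omega) (by omega)).2 (by omega)
  have hpath : W.IsPath := by
    rw [← Walk.IsPath.getVert_injOn_iff]
    intro i hi j hj hij
    simp only [Set.mem_ofPred_eq, hl] at hi hj
    rw [hW i hi, hW j hj] at hij
    exact hinj i j (by omega) (by omega) hij
  have hsup : ∀ z, z ∈ (Walk.cons hcl W).support ↔ ∃ i < n + 1, z = f i := by
    intro z
    rw [Walk.support_cons, List.mem_cons, hs]
    constructor
    · rintro (rfl | h)
      · exact ⟨n, by omega, rfl⟩
      · exact h
    · exact Or.inr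
  refine ⟨f n, Walk.cons hcl W, ⟨?_, by simp [hl]; omega, ?_⟩, by simp [hl], hsup⟩
  · rw [Walk.cons_isCycle_iff]
    refine ⟨hpath, ?_⟩
    rw [he]
    rintro ⟨i, hi, h⟩
    rw [Sym2.eq_iff] at h
    rcases h with ⟨h1, h2⟩ | ⟨h1, h2⟩
    · have := hinj _ _ (by omega) (by omega) h1; omega
    · have := hinj _ _ (by omega) (by omega) h1
      have := hinj _ _ (by omega) (by omega) h2
      omega
  · intro a ha b hb hab
    obtain ⟨i, hi, rfl⟩ := (hsup a).1 ha
    obtain ⟨j, hj, rfl⟩ := (hsup b).1 hb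
    rw [Walk.edges_cons, List.mem_cons, he]
    rcases (hadj _ _ hi hj).1 hab with h | h | h | h
    · subst h; exact Or.inr ⟨i, by omega, rfl⟩
    · subst h; exact Or.inr ⟨j, by omega, Sym2.eq_swap⟩
    · obtain ⟨rfl, rfl⟩ := h; exact Or.inl Sym2.eq_swap
    · obtain ⟨rfl, rfl⟩ := h; exact Or.inl rfl

/-- Two index ranges whose images are disjoint and have no edges in between. -/
def Anti (G : SimpleGraph V) (k₁ : ℕ) (g₁ : ℕ → V) (k₂ : ℕ) (g₂ : ℕ → V) : Prop :=
  ∀ i j, 0 < i → i < k₁ → 0 < j → j < k₂ → g₁ i ≠ g₂ j ∧ ¬ G.Adj (g₁ i) (g₂ j)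

lemma IPath.copy {k : ℕ} {g : ℕ → V} (hg : IPath G k g) {a b : V} (ha : g 0 = a) (hb : g k = b) :
    ∃ W : G.Walk a b, IsInducedPath W ∧ W.length = k ∧
      (∀ z, z ∈ W.support ↔ ∃ i ≤ k, z = g i) ∧
      ∀ z, z ∈ inter W ↔ ∃ i, 0 < i ∧ i < k ∧ z = g i := by
  subst ha hb
  obtain ⟨W, h1, h2, h3, -⟩ := hg.inducedPath
  exact ⟨W, h1, h2, h3, mem_inter_iff hg h3⟩

lemma hasLongTheta_of_IPath {a b : V} (hab : a ≠ b) (hadj : ¬ G.Adj a b) {k₁ k₂ k₃ : ℕ}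
    {g₁ g₂ g₃ : ℕ → V} (h₁ : IPath G k₁ g₁) (h₂ : IPath G k₂ g₂) (h₃ : IPath G k₃ g₃)
    (a₁ : g₁ 0 = a) (a₂ : g₂ 0 = a) (a₃ : g₃ 0 = a)
    (b₁ : g₁ k₁ = b) (b₂ : g₂ k₂ = b) (b₃ : g₃ k₃ = b)
    (h₁₂ : Anti G k₁ g₁ k₂ g₂) (h₁₃ : Anti G k₁ g₁ k₃ g₃) (h₂₃ : Anti G k₂ g₂ k₃ g₃)
    (l₁₂ : ℓ ≤ k₁ + k₂) (l₁₃ : ℓ ≤ k₁ + k₃) (l₂₃ : ℓ ≤ k₂ + k₃) : HasLongTheta G ℓ := by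
  obtain ⟨W₁, p₁, rfl, -, s₁⟩ := h₁.copy a₁ b₁
  obtain ⟨W₂, p₂, rfl, -, s₂⟩ := h₂.copy a₂ b₂
  obtain ⟨W₃, p₃, rfl, -, s₃⟩ := h₃.copy a₃ b₃
  refine ⟨a, b, W₁, W₂, W₃, hab, hadj, p₁, p₂, p₃, ?_, ?_, ?_, l₁₂, l₁₃, l₂₃⟩
  · intro z hz w hw
    obtain ⟨i, hi, hi', rfl⟩ := (s₁ z).1 hz
    obtain ⟨j, hj, hj', rfl⟩ := (s₂ w).1 hw
    exact h₁₂ i j hi hi' hj hj'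
  · intro z hz w hw
    obtain ⟨i, hi, hi', rfl⟩ := (s₁ z).1 hz
    obtain ⟨j, hj, hj', rfl⟩ := (s₃ w).1 hw
    exact h₁₃ i j hi hi' hj hj'
  · intro z hz w hw
    obtain ⟨i, hi, hi', rfl⟩ := (s₂ z).1 hz
    obtain ⟨j, hj, hj', rfl⟩ := (s₃ w).1 hw
    exact h₂₃ i j hi hi' hj hj'

lemma hasLongJewel_of_IPath {a b : V} (hab : a ≠ b) {k₁ k₂ k₃ : ℕ}
    {g₁ g₂ g₃ : ℕ → V} (h₁ : IPath G k₁ g₁) (h₂ : IPath G k₂ g₂) (h₃ : IPath G k₃ g₃)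
    (a₁ : g₁ 0 = a) (a₂ : g₂ 0 = a) (a₃ : g₃ 0 = a)
    (b₁ : g₁ k₁ = b) (b₂ : g₂ k₂ = b) (b₃ : g₃ k₃ = b)
    (hpar : ¬ (Even k₁ ↔ Even k₂)) (hlen : ℓ ≤ k₃ + min k₁ k₂)
    (h₃₁ : Anti G k₃ g₃ k₁ g₁) (h₃₂ : Anti G k₃ g₃ k₂ g₂) :
    HasLongJewel G ℓ (max (k₁ + 1) (k₂ + 1)) := by
  obtain ⟨W₁, p₁, rfl, -, s₁⟩ := h₁.copy a₁ b₁
  obtain ⟨W₂, p₂, rfl, -, s₂⟩ := h₂.copy a₂ b₂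
  obtain ⟨W₃, p₃, rfl, -, s₃⟩ := h₃.copy a₃ b₃
  refine ⟨a, b, W₁, W₂, W₃, hab, p₁, p₂, p₃, hpar, by simp, hlen, ?_⟩
  rintro z hz w (hw | hw)
  · obtain ⟨i, hi, hi', rfl⟩ := (s₃ z).1 hz
    obtain ⟨j, hj, hj', rfl⟩ := (s₁ w).1 hw
    exact h₃₁ i j hi hi' hj hj'
  · obtain ⟨i, hi, hi', rfl⟩ := (s₃ z).1 hz
    obtain ⟨j, hj, hj', rfl⟩ := (s₂ w).1 hw
    exact h₃₂ i j hi hi' hj hj'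

lemma IPath.reverse {k : ℕ} {g : ℕ → V} (hg : IPath G k g) : IPath G k (fun i => g (k - i)) := by
  intro i j hij hj
  have := hg (k - j) (k - i) (by omega) (by omega)
  refine ⟨this.1.symm, ?_⟩
  rw [G.adj_comm, this.2]; omega

lemma IPath.mono {k m : ℕ} {g : ℕ → V} (hg : IPath G k g) (h : m ≤ k) : IPath G m g :=
  fun i j hij hj => hg i j hij (by omega)

/-- Concatenation of two sequences, the first one indexed by `0, …, k`. -/
def join (k : ℕ) (g₁ g₂ : ℕ → V) : ℕ → V := fun i => if i ≤ k then g₁ i else g₂ (i - k - 1)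

lemma join_of_le {k i : ℕ} {g₁ g₂ : ℕ → V} (h : i ≤ k) : join k g₁ g₂ i = g₁ i := by
  simp [join, h]

lemma join_of_lt {k i : ℕ} {g₁ g₂ : ℕ → V} (h : k < i) : join k g₁ g₂ i = g₂ (i - k - 1) := by
  simp [join, show ¬ i ≤ k by omega]

lemma IPath.join {k₁ k₂ : ℕ} {g₁ g₂ : ℕ → V} (h₁ : IPath G k₁ g₁) (h₂ : IPath G k₂ g₂)
    (h : ∀ i j, i ≤ k₁ → j ≤ k₂ →
      g₁ i ≠ g₂ j ∧ (G.Adj (g₁ i) (g₂ j) ↔ i = k₁ ∧ j = 0)) :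
    IPath G (k₁ + k₂ + 1) (join k₁ g₁ g₂) := by
  intro i j hij hj
  by_cases hi : i ≤ k₁
  · by_cases hj' : j ≤ k₁
    · rw [join_of_le hi, join_of_le hj']
      exact h₁ i j hij hj'
    · rw [join_of_le hi, join_of_lt (by omega)]
      refine ⟨(h _ _ hi (by omega)).1, ?_⟩
      rw [(h _ _ hi (by omega)).2]; omega
  · rw [join_of_lt (by omega), join_of_lt (by omega)]
    refine ⟨(h₂ _ _ (by omega) (by omega)).1, ?_⟩
    rw [(h₂ _ _ (by omega) (by omega)).2]; omega

lemma IPath.single (z : V) : IPath G 0 (fun _ => z) := by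
  intro i j hij hj; omega

lemma IPath.snoc {k : ℕ} {g : ℕ → V} (hg : IPath G k g) {z : V}
    (h : ∀ i ≤ k, g i ≠ z ∧ (G.Adj (g i) z ↔ i = k)) :
    IPath G (k + 1) (LEH.join k g fun _ => z) :=
  hg.join (IPath.single z) fun i j hi hj => ⟨(h i hi).1, by rw [(h i hi).2]; omega⟩

lemma IPath.cons {k : ℕ} {g : ℕ → V} (hg : IPath G k g) {z : V}
    (h : ∀ i ≤ k, z ≠ g i ∧ (G.Adj z (g i) ↔ i = 0)) :
    IPath G (k + 1) (LEH.join 0 (fun _ => z) g) := by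
  have := (IPath.single z).join hg fun i j hi hj => ⟨(h j hj).1, by rw [(h j hj).2]; omega⟩
  simpa using this

/-- Closing an induced path by a vertex adjacent to exactly its ends. -/
lemma IPath.close {k : ℕ} {g : ℕ → V} (hg : IPath G k g) {z : V}
    (h : ∀ i ≤ k, z ≠ g i ∧ (G.Adj z (g i) ↔ i = 0 ∨ i = k)) :
    ICyc G (k + 2) (LEH.join k g fun _ => z) := by
  intro i j hij hj
  by_cases hj' : j ≤ k
  · rw [join_of_le (by omega), join_of_le hj', (hg i j hij hj').2]
    exact ⟨(hg i j hij hj').1, by omega⟩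
  · rw [join_of_le (by omega), join_of_lt (by omega), G.adj_comm, (h i (by omega)).2]
    exact ⟨(h i (by omega)).1.symm, by omega⟩

lemma ICyc.arc {n : ℕ} {f : ℕ → V} (hf : ICyc G n f) (hper : ∀ i, f (i + n) = f i)
    {s k : ℕ} (hs : s < n) (hk : k + 2 ≤ n) : IPath G k (fun i => f (s + i)) := by
  intro i j hij hj
  dsimp only
  by_cases h1 : s + j < n
  · rw [(hf _ _ (by omega : s + i < s + j) h1).2]
    exact ⟨(hf _ _ (by omega : s + i < s + j) h1).1, by omega⟩
  · have ej : f (s + j) = f (s + j - n) := by rw [← hper (s + j - n)]; congr 1; omega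
    rw [ej]
    by_cases h2 : s + i < n
    · have := hf (s + j - n) (s + i) (by omega) h2
      rw [G.adj_comm, this.2]
      exact ⟨this.1.symm, by omega⟩
    · have ei : f (s + i) = f (s + i - n) := by rw [← hper (s + i - n)]; congr 1; omega
      rw [ei]
      have := hf (s + i - n) (s + j - n) (by omega) (by omega)
      rw [this.2]
      exact ⟨this.1, by omega⟩

lemma hasLongNearPrism_of_apex {a₀ b₀ a₁ b₁ x : V} (W₀ : G.Walk a₀ b₀) (W₁ : G.Walk a₁ b₁)
    (p₀ : W₀.IsPath) (p₁ : W₁.IsPath) (hd : ∀ z ∈ W₀.support, z ∉ W₁.support)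
    (hx₀ : x ∉ W₀.support) (hx₁ : x ∉ W₁.support) (hab₀ : a₀ ≠ b₀) (hab₁ : a₁ ≠ b₁)
    (ha : G.Adj a₀ a₁) (ha₀ : G.Adj a₀ x) (ha₁ : G.Adj a₁ x)
    (hb : G.Adj b₀ b₁) (hb₀ : G.Adj b₀ x) (hb₁ : G.Adj b₁ x)
    (h₀₁ : IsLongHoleOn G ℓ (vset W₀ ∪ vset W₁)) (h₀ : IsLongHoleOn G ℓ (vset W₀ ∪ {x}))
    (h₁ : IsLongHoleOn G ℓ (vset W₁ ∪ {x})) : HasLongNearPrism G ℓ := by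
  have e : vset (Walk.nil : G.Walk x x) = {x} := by
    ext z; simp [vset]
  have ha₀b₁ : a₀ ≠ b₁ := fun h => hd a₀ W₀.start_mem_support (h ▸ W₁.end_mem_support)
  have ha₁b₀ : a₁ ≠ b₀ := fun h => hd b₀ W₀.end_mem_support (h ▸ W₁.start_mem_support)
  let P : ∀ i : Fin 3, G.Walk ((![a₀, a₁, x] : Fin 3 → V) i) ((![b₀, b₁, x] : Fin 3 → V) i) :=
    fun i => match i with
      | 0 => W₀
      | 1 => W₁
      | 2 => (Walk.nil : G.Walk x x)
  refine ⟨![a₀, a₁, x], ![b₀, b₁, x], P, ?_, ?_, ?_, ?_, ?_, ?_⟩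
  · intro i j hij
    fin_cases i <;> fin_cases j <;> first | exact absurd rfl hij | skip
    exacts [ha, ha₀, ha.symm, ha₁, ha₀.symm, ha₁.symm]
  · intro i j hij
    fin_cases i <;> fin_cases j <;> first | exact absurd rfl hij | skip
    exacts [hb, hb₀, hb.symm, hb₁, hb₀.symm, hb₁.symm]
  · have : ∀ z ∈ Set.range ![a₀, a₁, x] ∩ Set.range ![b₀, b₁, x], z = x := by
      rintro z ⟨⟨i, rfl⟩, ⟨j, hj⟩⟩
      fin_cases i <;> fin_cases j
      exacts [absurd hj.symm hab₀, absurd hj.symm ha₀b₁, hj.symm, absurd hj.symm ha₁b₀,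
        absurd hj.symm hab₁, hj.symm, rfl, rfl, rfl]
    intro z hz w hw
    rw [this z hz, this w hw]
  · intro i
    fin_cases i
    exacts [p₀, p₁, Walk.IsPath.nil]
  · have h1 : ∀ z ∈ W₁.support, z ∉ W₀.support := fun z hz hz' => hd z hz' hz
    have h2 : ∀ z ∈ W₀.support, z ∉ (Walk.nil : G.Walk x x).support := by
      intro z hz h
      rw [Walk.support_nil, List.mem_singleton] at h
      exact hx₀ (h ▸ hz)
    have h3 : ∀ z ∈ W₁.support, z ∉ (Walk.nil : G.Walk x x).support := by
      intro z hz h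
      rw [Walk.support_nil, List.mem_singleton] at h
      exact hx₁ (h ▸ hz)
    intro i j hij
    fin_cases i <;> fin_cases j <;> first | exact absurd rfl hij | skip
    exacts [hd, h2, h1, h3, fun z hz hz' => h2 z hz' hz, fun z hz hz' => h3 z hz' hz]
  · have c₀₁ := h₀₁
    have c₀ := h₀
    have c₁ := h₁
    rw [Set.union_comm] at c₀₁ c₀ c₁
    rw [← e] at h₀ h₁ c₀ c₁
    intro i j hij
    fin_cases i <;> fin_cases j <;> first | exact absurd rfl hij | skip
    exacts [h₀₁, h₀, c₀₁, h₁, c₀, c₁]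

lemma ICyc.isLongHoleOn {n : ℕ} {f : ℕ → V} (hf : ICyc G n f) (hn : 4 ≤ n) (hl : ℓ ≤ n)
    {S : Set V} (hS : ∀ z, z ∈ S ↔ ∃ i < n, z = f i) : IsLongHoleOn G ℓ S := by
  obtain ⟨v, c, h1, h2, h3⟩ := hf.hole hn
  refine ⟨v, c, h1, by omega, ?_⟩
  ext z
  rw [hS]
  exact h3 z

/-- A shortest path between two nonadjacent vertices with interior in an induced path. -/
lemma IPath.exists_link {k : ℕ} {g : ℕ → V} (hg : IPath G k g) {x y : V} (hxy : x ≠ y)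
    (hadj : ¬ G.Adj y x) (hx : ∀ i ≤ k, x ≠ g i) (hy : ∀ i ≤ k, y ≠ g i)
    (hxn : ∃ i ≤ k, G.Adj x (g i)) (hyn : ∃ i ≤ k, G.Adj y (g i)) :
    ∃ m h, IPath G m h ∧ 2 ≤ m ∧ h 0 = y ∧ h m = x ∧
      ∀ t, 0 < t → t < m → ∃ i ≤ k, h t = g i := by
  have aux : ∀ g : ℕ → V, IPath G k g → (∀ i ≤ k, x ≠ g i) → (∀ i ≤ k, y ≠ g i) →
      ∀ i j, i ≤ j → j ≤ k → G.Adj y (g i) → G.Adj x (g j) →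
      (∀ t, i ≤ t → t ≤ j → G.Adj y (g t) → t = i) →
      (∀ t, i ≤ t → t ≤ j → G.Adj x (g t) → t = j) →
      ∃ m h, IPath G m h ∧ 2 ≤ m ∧ h 0 = y ∧ h m = x ∧
        ∀ t, 0 < t → t < m → ∃ i ≤ k, h t = g i := by
    intro g hg hx hy i j hij hj hyi hxj hyu hxu
    have h1 : IPath G (j - i) (fun t => g (i + t)) := by
      intro s t hst ht
      have := hg (i + s) (i + t) (by omega) (by omega)
      exact ⟨this.1, by rw [this.2]; omega⟩
    have h2 := h1.snoc (z := x) (fun t ht => ⟨(hx _ (by omega)).symm, by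
      rw [G.adj_comm]
      constructor
      · intro h
        have := hxu (i + t) (by omega) (by omega) h
        omega
      · rintro rfl
        rwa [show i + (j - i) = j by omega]⟩)
    have h3 := h2.cons (z := y) (fun t ht => by
      by_cases htj : t ≤ j - i
      · rw [join_of_le htj]
        refine ⟨hy _ (by omega), fun h => ?_, ?_⟩
        · have := hyu (i + t) (by omega) (by omega) h
          omega
        · rintro rfl; exact hyi
      · rw [join_of_lt (by omega)]
        exact ⟨hxy.symm, fun h => absurd h hadj, by omega⟩)
    refine ⟨_, _, h3, by omega, join_of_le le_rfl, ?_, ?_⟩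
    · rw [join_of_lt (by omega), join_of_lt (by omega)]
    · intro t ht0 ht
      rw [join_of_lt (by omega), join_of_le (by omega)]
      exact ⟨i + (t - 0 - 1), by omega, rfl⟩
  have hex : ∃ d i j, i ≤ k ∧ j ≤ k ∧ G.Adj y (g i) ∧ G.Adj x (g j) ∧
      (i + d = j ∨ j + d = i) := by
    obtain ⟨j, hj, hxj⟩ := hxn
    obtain ⟨i, hi, hyi⟩ := hyn
    rcases le_total i j with h | h
    · exact ⟨j - i, i, j, hi, hj, hyi, hxj, by omega⟩
    · exact ⟨i - j, i, j, hi, hj, hyi, hxj, by omega⟩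
  classical
  obtain ⟨i, j, hi, hj, hyi, hxj, hd⟩ := Nat.find_spec hex
  have hmin : ∀ d i j, i ≤ k → j ≤ k → G.Adj y (g i) → G.Adj x (g j) →
      (i + d = j ∨ j + d = i) → Nat.find hex ≤ d :=
    fun d i j a b c e h => Nat.find_min' hex ⟨i, j, a, b, c, e, h⟩
  generalize Nat.find hex = d at hd hmin
  rcases hd with hd | hd
  · refine aux g hg hx hy i j (by omega) hj hyi hxj ?_ ?_
    · intro t h1 h2 h3
      have := hmin (j - t) t j (by omega) hj h3 hxj (by omega)
      omega
    · intro t h1 h2 h3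
      have := hmin (t - i) i t hi (by omega) hyi h3 (by omega)
      omega
  · obtain ⟨m, h, h1, h2, h3, h4, h5⟩ := aux (fun t => g (k - t)) hg.reverse
      (fun t _ => hx _ (by omega)) (fun t _ => hy _ (by omega)) (k - i) (k - j) (by omega)
      (by omega) (by rwa [show k - (k - i) = i by omega])
      (by rwa [show k - (k - j) = j by omega]) (by
        intro t h1 h2 h3
        have := hmin (k - t - j) (k - t) j (by omega) hj h3 hxj (by omega)
        omega) (by
        intro t h1 h2 h3
        have := hmin (i - (k - t)) i (k - t) hi (by omega) hyi h3 (by omega)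
        omega)
    refine ⟨m, h, h1, h2, h3, h4, fun t ht ht' => ?_⟩
    obtain ⟨i, hi, e⟩ := h5 t ht ht'
    exact ⟨k - i, by omega, e⟩

/-- The vertex `z` is major for the induced cycle `f`. -/
def Major (G : SimpleGraph V) (n : ℕ) (f : ℕ → V) (z : V) : Prop :=
  (∀ i, z ≠ f i) ∧ ∀ m < n, ∃ i < n, G.Adj z (f i) ∧ i ≠ m ∧ ¬ G.Adj (f m) (f i)

/-- A minimum even induced cycle of length at least `ℓ`, listed periodically. -/
structure MinCyc (G : SimpleGraph V) (ℓ n : ℕ) (f : ℕ → V) : Prop where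
  cyc : ICyc G n f
  per : ∀ i, f (i + n) = f i
  even : Even n
  le : ℓ ≤ n
  min : ∀ k g, ICyc G k g → ℓ ≤ k → Even k → n ≤ k

lemma MinCyc.odd_of_close {n : ℕ} {f : ℕ → V} (H : MinCyc G ℓ n f) {k : ℕ} {g : ℕ → V}
    (hg : IPath G k g) {z : V} (h : ∀ i ≤ k, z ≠ g i ∧ (G.Adj z (g i) ↔ i = 0 ∨ i = k))
    (hl : ℓ ≤ k + 2) (hk : k + 2 < n) : Odd k := by
  by_contra ho
  rw [Nat.not_odd_iff_even] at ho
  have := H.min _ _ (hg.close h) hl (by simpa [Nat.even_add] using ho)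
  omega

lemma ipath_two {a z b : V} (haz : G.Adj a z) (hzb : G.Adj z b) (hab : a ≠ b)
    (hnab : ¬ G.Adj a b) :
    IPath G 2 (fun i => if i = 0 then a else if i = 1 then z else b) := by
  intro i j hij hj
  have : (i = 0 ∧ j = 1) ∨ (i = 0 ∧ j = 2) ∨ (i = 1 ∧ j = 2) := by omega
  rcases this with ⟨rfl, rfl⟩ | ⟨rfl, rfl⟩ | ⟨rfl, rfl⟩
  · simpa using ⟨haz.ne, haz⟩
  · simpa using ⟨hab, hnab⟩
  · simpa using ⟨hzb.ne, hzb⟩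

/-- A major vertex with a long gap `f 0, …, f p` attaches to the rest of the cycle. -/
lemma MinCyc.long_gap {n : ℕ} {f : ℕ → V} (H : MinCyc G ℓ n f) (hℓ : 6 ≤ ℓ)
    (hJ : ¬ ∃ k ≤ ℓ + 1, HasLongJewel G ℓ k) (hT : ¬ HasLongTheta G ℓ)
    (hN : ¬ HasLongNearPrism G ℓ) {x : V} (hx : Major G n f x) {p : ℕ} (hpn : p < n)
    (hpl : ℓ ≤ p + 2) (h0 : G.Adj x (f 0)) (hp : G.Adj x (f p))
    (hgap : ∀ i, 0 < i → i < p → ¬ G.Adj x (f i)) :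
    Odd p ∧ p + ℓ + 1 ≤ n ∧ ∃ i, p + 2 ≤ i ∧ i + 2 ≤ n ∧ G.Adj x (f i) := by
  have fn : f n = f 0 := by simpa using H.per 0
  have hn3 : p + 3 ≤ n := by
    by_contra hlt
    obtain ⟨i, hi, hai, hne, hnadj⟩ := hx.2 (n - 1) (by omega)
    have hi' : i = 0 ∨ p ≤ i := by
      by_contra hcon
      exact hgap i (by omega) (by omega) hai
    have := H.cyc i (n - 1) (by omega) (by omega)
    rw [G.adj_comm, this.2] at hnadj
    omega
  have hP : IPath G p f := by simpa using H.cyc.arc H.per (s := 0) (k := p) (by omega) (by omega)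
  have hxP : ∀ i ≤ p, x ≠ f i ∧ (G.Adj x (f i) ↔ i = 0 ∨ i = p) := by
    refine fun i hi => ⟨hx.1 i, fun h => ?_, ?_⟩
    · by_contra hcon
      exact hgap i (by omega) (by omega) h
    · rintro (rfl | rfl)
      exacts [h0, hp]
  have hodd : Odd p := H.odd_of_close hP hxP hpl (by omega)
  have hn2 := H.even
  have hQ : IPath G (n - p) (fun i => f (n - i)) := by
    have h := (H.cyc.arc H.per (s := p) (k := n - p) hpn (by omega)).reverse
    intro i j hij hj
    have := h i j hij hj
    dsimp only at this
    rwa [show p + (n - p - i) = n - i by omega, show p + (n - p - j) = n - j by omega] at this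
  have h0p := H.cyc 0 p (by omega) hpn
  have h0p' : ¬ G.Adj (f 0) (f p) := by rw [h0p.2]; omega
  have hX := ipath_two h0.symm hp h0p.1 h0p'
  have aPX : Anti G p f 2 (fun i => if i = 0 then f 0 else if i = 1 then x else f p) := by
    intro i j hi hi' hj hj'
    obtain rfl : j = 1 := by omega
    simpa [G.adj_comm] using ⟨(hx.1 i).symm, hgap i hi hi'⟩
  have aPQ : Anti G p f (n - p) (fun i => f (n - i)) := by
    intro i j hi hi' hj hj'
    have := H.cyc i (n - j) (by omega) (by omega)
    exact ⟨this.1, by rw [this.2]; omega⟩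
  have hoQ : Odd (n - p) := by
    rw [Nat.odd_iff] at hodd ⊢
    rw [Nat.even_iff] at hn2
    omega
  have hQl : p + ℓ + 1 ≤ n := by
    by_contra hlt
    refine hJ ⟨_, ?_, hasLongJewel_of_IPath h0p.1 hX hQ hP rfl fn rfl rfl
      (by congr 1; omega) rfl ?_ ?_ aPX aPQ⟩
    · omega
    · simp [hoQ]
    · omega
  refine ⟨hodd, hQl, ?_⟩
  by_contra hno
  push Not at hno
  have harc : ∀ s k, s < n → k + 2 ≤ n → IPath G k (fun i => f (s + i)) :=
    fun s k h h' => H.cyc.arc H.per h h'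
  have hQdeep : ∀ i, p < i → i < n → G.Adj x (f i) → i = p + 1 ∨ i = n - 1 := by
    intro i h1 h2 h
    by_contra hcon
    exact hno i (by omega) (by omega) h
  have parity : ¬ Odd (n - p - 1) := by
    rw [Nat.odd_iff] at hoQ ⊢
    omega
  by_cases c1 : G.Adj x (f (p + 1)) <;> by_cases c2 : G.Adj x (f (n - 1))
  · have hR := (harc (p + 1) (n - p - 2) (by omega) (by omega))
    have hxR : ∀ i ≤ n - p - 2, x ≠ f (p + 1 + i) ∧
        (G.Adj x (f (p + 1 + i)) ↔ i = 0 ∨ i = n - p - 2) := by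
      refine fun i hi => ⟨hx.1 _, fun h => ?_, ?_⟩
      · have := hQdeep _ (by omega) (by omega) h
        omega
      · rintro (rfl | rfl)
        · exact c1
        · rwa [show p + 1 + (n - p - 2) = n - 1 by omega]
    obtain ⟨W₀, w₀, -, s₀, -⟩ := hP.inducedPath
    obtain ⟨W₁, w₁, -, s₁, -⟩ := hR.reverse.copy (a := f (n - 1)) (b := f (p + 1))
      (by congr 1; omega) (by congr 1; omega)
    have s₁' : ∀ z, z ∈ W₁.support ↔ ∃ i, p < i ∧ i < n ∧ z = f i := by
      intro z
      rw [s₁]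
      constructor
      · rintro ⟨i, hi, rfl⟩
        exact ⟨_, by omega, by omega, rfl⟩
      · rintro ⟨i, hi, hi', rfl⟩
        exact ⟨n - 1 - i, by omega, by congr 1; omega⟩
    refine hN (hasLongNearPrism_of_apex (x := x) W₀ W₁ w₀.1 w₁.1 ?_ ?_ ?_ h0p.1 ?_ ?_ h0.symm
      c2.symm ?_ hp.symm c1.symm ?_ ?_ ?_)
    · intro z hz hz'
      obtain ⟨i, hi, rfl⟩ := (s₀ z).1 hz
      obtain ⟨j, hj, hj', e⟩ := (s₁' _).1 hz'
      exact (H.cyc i j (by omega) hj').1 e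
    · intro h
      obtain ⟨i, hi, e⟩ := (s₀ x).1 h
      exact hx.1 i e
    · intro h
      obtain ⟨i, hi, hi', e⟩ := (s₁' x).1 h
      exact hx.1 i e
    · exact (H.cyc (p + 1) (n - 1) (by omega) (by omega)).1.symm
    · rw [(H.cyc 0 (n - 1) (by omega) (by omega)).2]; omega
    · rw [(H.cyc p (p + 1) (by omega) (by omega)).2]; omega
    · refine H.cyc.isLongHoleOn (by omega) H.le fun z => ?_
      change (z ∈ W₀.support ∨ z ∈ W₁.support) ↔ _
      rw [s₀, s₁']
      constructor
      · rintro (⟨i, hi, rfl⟩ | ⟨i, hi, hi', rfl⟩)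
        exacts [⟨i, by omega, rfl⟩, ⟨i, by omega, rfl⟩]
      · rintro ⟨i, hi, rfl⟩
        by_cases h : i ≤ p
        exacts [Or.inl ⟨i, h, rfl⟩, Or.inr ⟨i, by omega, hi, rfl⟩]
    · refine (hP.close hxP).isLongHoleOn (by omega) (by omega) fun z => ?_
      change (z ∈ W₀.support ∨ z = x) ↔ _
      rw [s₀]
      constructor
      · rintro (⟨i, hi, rfl⟩ | rfl)
        exacts [⟨i, by omega, (join_of_le hi).symm⟩,
          ⟨p + 1, by omega, by rw [join_of_lt (by omega)]⟩]
      · rintro ⟨i, hi, rfl⟩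
        by_cases h : i ≤ p
        exacts [Or.inl ⟨i, h, join_of_le h⟩, Or.inr (join_of_lt (by omega))]
    · refine (hR.close hxR).isLongHoleOn (by omega) (by omega) fun z => ?_
      change (z ∈ W₁.support ∨ z = x) ↔ _
      rw [s₁']
      constructor
      · rintro (⟨i, hi, hi', rfl⟩ | rfl)
        · refine ⟨i - (p + 1), by omega, ?_⟩
          rw [join_of_le (by omega)]
          congr 1; omega
        · exact ⟨n - p - 2 + 1, by omega, by rw [join_of_lt (by omega)]⟩
      · rintro ⟨i, hi, rfl⟩
        by_cases h : i ≤ n - p - 2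
        exacts [Or.inl ⟨p + 1 + i, by omega, by omega, join_of_le h⟩,
          Or.inr (join_of_lt (by omega))]
  · refine parity (H.odd_of_close (harc (p + 1) (n - p - 1) (by omega) (by omega)) (z := x) ?_
      (by omega) (by omega))
    refine fun i hi => ⟨hx.1 _, fun h => ?_, ?_⟩
    · by_contra hcon
      have := hQdeep _ (by omega) (by omega) h
      have h1 : p + 1 + i = n - 1 := by omega
      rw [h1] at h
      exact c2 h
    · rintro (rfl | rfl)
      · exact c1
      · rwa [show p + 1 + (n - p - 1) = n by omega, fn]
  · refine parity (H.odd_of_close (harc p (n - p - 1) (by omega) (by omega)) (z := x) ?_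
      (by omega) (by omega))
    refine fun i hi => ⟨hx.1 _, fun h => ?_, ?_⟩
    · by_contra hcon
      have := hQdeep _ (by omega) (by omega) h
      have h1 : p + i = p + 1 := by omega
      rw [h1] at h
      exact c1 h
    · rintro (rfl | rfl)
      · exact hp
      · rwa [show p + (n - p - 1) = n - 1 by omega]
  · refine hT (hasLongTheta_of_IPath h0p.1 h0p' hP hX hQ rfl rfl fn rfl rfl
      (by congr 1; omega) aPX aPQ ?_ (by omega) (by omega) (by omega))
    intro i j hi hi' hj hj'
    obtain rfl : i = 1 := by omega
    refine ⟨hx.1 _, fun h => ?_⟩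
    change G.Adj x (f (n - j)) at h
    rcases hQdeep (n - j) (by omega) (by omega) h with e | e
    · rw [e] at h; exact c1 h
    · rw [e] at h; exact c2 h

lemma MinCyc.attachment {n : ℕ} {f : ℕ → V} (H : MinCyc G ℓ n f) (hℓ : 6 ≤ ℓ)
    (hJ : ¬ ∃ k ≤ ℓ + 1, HasLongJewel G ℓ k) (hT : ¬ HasLongTheta G ℓ)
    (hN : ¬ HasLongNearPrism G ℓ) {x y : V} (hx : Major G n f x) (hy : Major G n f y)
    (hxy : ¬ G.Adj x y) {p : ℕ} (hpn : p < n) (hpl : ℓ ≤ p + 2)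
    (h0 : G.Adj x (f 0)) (hp : G.Adj x (f p)) (hgap : ∀ i, 0 < i → i < p → ¬ G.Adj x (f i))
    (hdeep : ∀ i ≤ p, G.Adj y (f i) → ℓ ≤ i + 4 ∧ ℓ + i ≤ p + 4)
    (hq₁ : ¬ G.Adj y (f (n - 1))) (hq₂ : ¬ G.Adj y (f (p + 1)))
    (hyn : ∃ i ≤ p, G.Adj y (f i)) :
    ∃ a, a + 1 ≤ p ∧ G.Adj y (f a) ∧ G.Adj y (f (a + 1)) ∧
      ∀ i ≤ p, G.Adj y (f i) → i = a ∨ i = a + 1 := by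
  obtain ⟨hodd, hpn', hxQ⟩ := H.long_gap hℓ hJ hT hN hx hpn hpl h0 hp hgap
  have fn : f n = f 0 := by simpa using H.per 0
  have hne : x ≠ y := by
    rintro rfl
    have := hdeep 0 (by omega) h0
    omega
  have hyx : ¬ G.Adj y x := fun h => hxy h.symm
  have hn2 := H.even
  have harc : ∀ s k, s < n → k + 2 ≤ n → IPath G k (fun i => f (s + i)) :=
    fun s k h h' => H.cyc.arc H.per h h'
  have hP : IPath G p f := by simpa using harc 0 p (by omega) (by omega)
  obtain ⟨a, ⟨hap, hya⟩, hamin⟩ : ∃ a, (a ≤ p ∧ G.Adj y (f a)) ∧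
      ∀ i ≤ p, G.Adj y (f i) → a ≤ i := by
    classical
    exact ⟨Nat.find hyn, Nat.find_spec hyn, fun i hi h => Nat.find_min' hyn ⟨hi, h⟩⟩
  obtain ⟨b, ⟨hbp, hyb⟩, hbmax⟩ : ∃ b, (b ≤ p ∧ G.Adj y (f b)) ∧
      ∀ i ≤ p, G.Adj y (f i) → i ≤ b := by
    classical
    refine ⟨Nat.findGreatest (fun i => G.Adj y (f i)) p,
      ⟨Nat.findGreatest_le _, Nat.findGreatest_spec (P := fun i => G.Adj y (f i)) hap hya⟩, fun i hi h => ?_⟩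
    exact Nat.le_findGreatest hi h
  have hab : a ≤ b := hamin b hbp hyb
  have ha := hdeep a hap hya
  have hb := hdeep b hbp hyb
  by_cases hb1 : b = a + 1
  · subst hb1
    refine ⟨a, hbp, hya, hyb, fun i hi h => ?_⟩
    have := hamin i hi h
    have := hbmax i hi h
    omega
  exfalso
  -- the subpaths from `f a` and `f b` to `x`
  have hA := (hP.mono hap).reverse.snoc (z := x) (fun i hi => ⟨(hx.1 _).symm, by
    rw [G.adj_comm]
    constructor
    · intro h
      by_contra hcon
      exact hgap (a - i) (by omega) (by omega) h
    · rintro rfl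
      rwa [Nat.sub_self]⟩)
  have hB := (harc b (p - b) (by omega) (by omega)).snoc (z := x)
    (fun i hi => ⟨(hx.1 _).symm, by
      rw [G.adj_comm]
      constructor
      · intro h
        by_contra hcon
        exact hgap (b + i) (by omega) (by omega) h
      · rintro rfl
        rwa [show b + (p - b) = p by omega]⟩)
  by_cases hyQ : ∃ i, p + 2 ≤ i ∧ i + 2 ≤ n ∧ G.Adj y (f i)
  · have conv : ∀ z, (∃ i, p + 2 ≤ i ∧ i + 2 ≤ n ∧ G.Adj z (f i)) →
        ∃ i ≤ n - p - 4, G.Adj z (f (p + 2 + i)) := by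
      rintro z ⟨i, h1, h2, h3⟩
      exact ⟨i - (p + 2), by omega, by rwa [show p + 2 + (i - (p + 2)) = i by omega]⟩
    obtain ⟨m, h, hR, hm, hr0, hrm, hrint⟩ :=
      (harc (p + 2) (n - p - 4) (by omega) (by omega)).exists_link hne hyx
        (fun i _ => hx.1 _) (fun i _ => hy.1 _) (conv x hxQ) (conv y hyQ)
    have hRP : ∀ i t, i ≤ p → 0 < t → t < m → f i ≠ h t ∧ ¬ G.Adj (f i) (h t) := by
      intro i t hi ht ht'
      obtain ⟨j, hj, e⟩ := hrint t ht ht'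
      rw [e]
      have := H.cyc i (p + 2 + j) (by omega) (by omega)
      exact ⟨this.1, by rw [this.2]; omega⟩
    by_cases hba : b = a
    · subst hba
      have hC := hR.cons (z := f b) (fun i hi => by
        rcases Nat.eq_zero_or_pos i with rfl | hi0
        · rw [hr0]
          exact ⟨(hy.1 _).symm, by simpa using hyb.symm⟩
        · by_cases him : i < m
          · have := hRP b i hbp hi0 him
            exact ⟨this.1, fun h => absurd h this.2, by omega⟩
          · obtain rfl : i = m := by omega
            rw [hrm]
            exact ⟨(hx.1 _).symm, fun h => absurd h.symm (hgap b (by omega) (by omega)),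
              by omega⟩)
      have anti : ∀ i t, i ≤ p → i ≠ b → 0 < t → t < m + 1 →
          f i ≠ LEH.join 0 (fun _ => f b) h t ∧ ¬ G.Adj (f i) (LEH.join 0 (fun _ => f b) h t) := by
        intro i t hi hib ht ht'
        rw [join_of_lt ht]
        by_cases h1 : t = 1
        · subst h1
          rw [show h (1 - 0 - 1) = y from hr0]
          refine ⟨(hy.1 _).symm, fun hadj => hib ?_⟩
          have := hamin i hi hadj.symm
          have := hbmax i hi hadj.symm
          omega
        · exact hRP i _ hi (by omega) (by omega)
      refine hT (hasLongTheta_of_IPath (a := f b) (b := x) (hx.1 _).symm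
        (fun h => hgap b (by omega) (by omega) h.symm) hA hB hC ?_ ?_ ?_ ?_ ?_ ?_ ?_ ?_ ?_
        (by omega) (by omega) (by omega))
      · rw [join_of_le (by omega), Nat.sub_zero]
      · rw [join_of_le (by omega), Nat.add_zero]
      · rw [join_of_le le_rfl]
      · rw [join_of_lt (by omega)]
      · rw [join_of_lt (by omega)]
      · rw [join_of_lt (by omega)]; exact hrm
      · intro i j hi hi' hj hj'
        rw [join_of_le (by omega), join_of_le (by omega)]
        have := H.cyc (b - i) (b + j) (by omega) (by omega)
        exact ⟨this.1, by rw [this.2]; omega⟩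
      · intro i j hi hi' hj hj'
        rw [join_of_le (by omega)]
        exact anti (b - i) j (by omega) (by omega) hj (by omega)
      · intro i j hi hi' hj hj'
        rw [join_of_le (by omega)]
        exact anti (b + i) j (by omega) (by omega) hj (by omega)
    · have hyA := hA.cons (z := y) (fun i hi => by
        by_cases hia : i ≤ a
        · rw [join_of_le hia]
          refine ⟨hy.1 _, fun h => ?_, ?_⟩
          · have := hamin _ (by omega) h
            omega
          · rintro rfl; exact hya
        · rw [join_of_lt (by omega)]
          exact ⟨hne.symm, fun h => absurd h hyx, by omega⟩)
      have hyB := hB.cons (z := y) (fun i hi => by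
        by_cases hia : i ≤ p - b
        · rw [join_of_le hia]
          refine ⟨hy.1 _, fun h => ?_, ?_⟩
          · have := hbmax _ (by omega) h
            omega
          · rintro rfl; exact hyb
        · rw [join_of_lt (by omega)]
          exact ⟨hne.symm, fun h => absurd h hyx, by omega⟩)
      refine hT (hasLongTheta_of_IPath (a := y) (b := x) hne.symm hyx hyA hyB hR ?_ ?_ hr0 ?_ ?_
        hrm ?_ ?_ ?_ (by omega) (by omega) (by omega))
      · rw [join_of_le le_rfl]
      · rw [join_of_le le_rfl]
      · rw [join_of_lt (by omega), join_of_lt (by omega)]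
      · rw [join_of_lt (by omega), join_of_lt (by omega)]
      · intro i j hi hi' hj hj'
        rw [join_of_lt hi, join_of_le (by omega), join_of_lt hj, join_of_le (by omega)]
        have := H.cyc (a - (i - 0 - 1)) (b + (j - 0 - 1)) (by omega) (by omega)
        exact ⟨this.1, by rw [this.2]; omega⟩
      · intro i j hi hi' hj hj'
        rw [join_of_lt hi, join_of_le (by omega)]
        exact hRP _ j (by omega) hj hj'
      · intro i j hi hi' hj hj'
        rw [join_of_lt hi, join_of_le (by omega)]
        exact hRP _ j (by omega) hj hj'
  · have hyab : ∀ i < n, G.Adj y (f i) → a ≤ i ∧ i ≤ b := by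
      intro i hi h
      by_cases hip : i ≤ p
      · exact ⟨hamin i hip h, hbmax i hip h⟩
      · exfalso
        by_cases h1 : i = p + 1
        · subst h1; exact hq₂ h
        · by_cases h2 : i = n - 1
          · subst h2; exact hq₁ h
          · exact hyQ ⟨i, by omega, by omega, h⟩
    have hab3 : a + 3 ≤ b := by
      by_contra hlt
      obtain ⟨i, hi, h1, h2, h3⟩ := hy.2 (a + 1) (by omega)
      have := hyab i hi h1
      rcases Nat.lt_or_ge i (a + 1) with h4 | h4
      · rw [G.adj_comm, (H.cyc i (a + 1) h4 (by omega)).2] at h3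
        omega
      · rw [(H.cyc (a + 1) i (by omega) hi).2] at h3
        omega
    have hodd' : Odd (n - b + a) := by
      refine H.odd_of_close (harc b (n - b + a) (by omega) (by omega)) (z := y) ?_
        (by omega) (by omega)
      refine fun i hi => ⟨hy.1 _, fun h => ?_, ?_⟩
      · by_cases hin : b + i < n
        · have := hyab _ hin h
          omega
        · have e : f (b + i) = f (b + i - n) := by
            rw [← H.per (b + i - n)]; congr 1; omega
          rw [e] at h
          have := hyab _ (by omega) h
          omega
      · rintro (rfl | rfl)
        · exact hyb
        · have e : f (b + (n - b + a)) = f a := by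
            rw [← H.per a]; congr 1; omega
          rwa [e]
    have hBr : IPath G (p - b) (fun i => f (p - i)) := by
      have := (harc b (p - b) (by omega) (by omega)).reverse
      intro i j hij hj
      have := this i j hij hj
      dsimp only at this
      rwa [show b + (p - b - i) = p - i by omega, show b + (p - b - j) = p - j by omega] at this
    have hL := hA.join hBr (fun i j hi hj => by
      by_cases hia : i ≤ a
      · rw [join_of_le hia]
        have := H.cyc (a - i) (p - j) (by omega) (by omega)
        exact ⟨this.1, by rw [this.2]; omega⟩
      · rw [join_of_lt (by omega)]
        refine ⟨hx.1 _, fun h => ?_, ?_⟩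
        · by_contra hcon
          exact hgap (p - j) (by omega) (by omega) h
        · rintro ⟨-, rfl⟩
          exact hp)
    have hodd'' := H.odd_of_close hL (z := y) (fun i hi => by
      by_cases hia : i ≤ a
      · rw [join_of_le (by omega), join_of_le hia]
        refine ⟨hy.1 _, fun h => ?_, ?_⟩
        · have := hyab _ (by omega) h
          omega
        · rintro (rfl | rfl)
          · exact hya
          · omega
      · by_cases hia' : i = a + 1
        · subst hia'
          rw [join_of_le (by omega), join_of_lt (by omega)]
          exact ⟨hne.symm, fun h => absurd h hyx, by omega⟩
        · rw [join_of_lt (by omega)]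
          refine ⟨hy.1 _, fun h => ?_, ?_⟩
          · have := hyab _ (by omega) h
            omega
          · rintro (rfl | rfl)
            · omega
            · rwa [show p - (a + 1 + (p - b) + 1 - (a + 1) - 1) = b by omega]) (by omega) (by omega)
    rw [Nat.odd_iff] at hodd hodd' hodd''
    rw [Nat.even_iff] at hn2
    omega

lemma listIdx_le {l : List V} {v : V} {i : ℕ} (hi : i < l.length) (h : l[i] = v) :
    listIdx l v ≤ i := by
  by_contra hlt
  have := List.not_of_lt_findIdx (Nat.lt_of_not_le hlt)
  simp [h] at this

lemma listIdx_support_getVert_le {u v : V} (W : G.Walk u v) {i : ℕ} (hi : i ≤ W.length) :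
    listIdx W.support (W.getVert i) ≤ i :=
  listIdx_le (by rw [Walk.length_support]; omega) (by simp [Walk.support_getElem_eq_getVert])

lemma _root_.SimpleGraph.Walk.IsCycle.icyc {u : V} {c : G.Walk u u} (hc : c.IsCycle)
    (hch : ∀ x ∈ c.support, ∀ y ∈ c.support, G.Adj x y → s(x, y) ∈ c.edges) :
    ICyc G c.length c.getVert := by
  intro i j hij hj
  have inj := hc.getVert_injOn'
  have hinj : ∀ i j, i < c.length → j < c.length → c.getVert i = c.getVert j → i = j :=
    fun i j hi hj h => inj (by simp only [Set.mem_ofPred_eq]; omega)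
      (by simp only [Set.mem_ofPred_eq]; omega) h
  have h0 : c.getVert c.length = c.getVert 0 := by simp
  refine ⟨fun h => by have := hinj i j (by omega) hj h; omega, fun h => ?_, ?_⟩
  · have := hch _ (c.getVert_mem_support i) _ (c.getVert_mem_support j) h
    obtain ⟨k, hk, e⟩ := (mem_edges_iff_getVert c _).1 this
    rw [Sym2.eq_iff] at e
    by_cases hk' : k + 1 = c.length
    · rw [hk', h0] at e
      rcases e with ⟨e1, e2⟩ | ⟨e1, e2⟩
      · have := hinj _ _ (by omega) (by omega) e1
        have := hinj _ _ (by omega) (by omega) e2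
        omega
      · have := hinj _ _ (by omega) (by omega) e1
        have := hinj _ _ (by omega) (by omega) e2
        omega
    · rcases e with ⟨e1, e2⟩ | ⟨e1, e2⟩
      · have := hinj _ _ (by omega) (by omega) e1
        have := hinj _ _ (by omega) (by omega) e2
        omega
      · have := hinj _ _ (by omega) (by omega) e1
        have := hinj _ _ (by omega) (by omega) e2
        omega
  · rintro (rfl | ⟨rfl, h⟩)
    · exact c.adj_getVert_succ (by omega)
    · have := c.adj_getVert_succ hj
      rw [h, h0] at this
      exact this.symm

/-- The periodic listing of a hole whose first vertices are those of a given subpath. -/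
lemma IsHole.exists_listing {u : V} {c : G.Walk u u} (hc : IsHole c) {p₁ p₂ : V}
    {P : G.Walk p₁ p₂} (hP : P.IsPath) (hPc : ∀ e ∈ P.edges, e ∈ c.edges) (hl : 1 ≤ P.length) :
    ∃ f : ℕ → V, ICyc G c.length f ∧ (∀ i, f (i + c.length) = f i) ∧
      (∀ z, z ∈ c.support ↔ ∃ i < c.length, z = f i) ∧
      P.length < c.length ∧ ∀ i ≤ P.length, P.getVert i = f i := by
  have hPe : ∀ i < P.length, s(P.getVert i, P.getVert (i + 1)) ∈ c.edges := fun i hi =>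
    hPc _ ((mem_edges_iff_getVert P _).2 ⟨i, hi, rfl⟩)
  have hp₁ : p₁ ∈ c.support := by
    have := Walk.fst_mem_support_of_mem_edges c (hPe 0 (by omega))
    simpa using this
  have main : ∀ d : G.Walk p₁ p₁, d.IsCycle → (∀ e, e ∈ d.edges ↔ e ∈ c.edges) →
      (∀ z, z ∈ d.support ↔ z ∈ c.support) → d.length = c.length →
      P.getVert 1 = d.getVert 1 →
      ∃ f : ℕ → V, ICyc G c.length f ∧ (∀ i, f (i + c.length) = f i) ∧
        (∀ z, z ∈ c.support ↔ ∃ i < c.length, z = f i) ∧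
        P.length < c.length ∧ ∀ i ≤ P.length, P.getVert i = f i := by
    intro d hd hde hds hdl h1
    have hdc := hd.icyc (fun x hx y hy h => (hde _).2 (hc.2.2 x ((hds x).1 hx) y ((hds y).1 hy) h))
    have hn := hc.2.1
    have hmod : ∀ i < c.length, d.getVert (i % c.length) = d.getVert i := fun i hi => by
      rw [Nat.mod_eq_of_lt hi]
    have hcyc : ICyc G c.length (fun i => d.getVert (i % c.length)) := by
      intro i j hij hj
      dsimp only
      rw [hmod i (by omega), hmod j hj]
      have := hdc i j hij (by omega)
      rwa [hdl] at this
    have inj := hP.getVert_injOn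
    have hPinj : ∀ i j, i ≤ P.length → j ≤ P.length → P.getVert i = P.getVert j → i = j :=
      fun i j hi hj h => inj hi hj h
    have hlist : ∀ i ≤ P.length, i < c.length ∧ P.getVert i = d.getVert i := by
      intro i
      induction i using Nat.strong_induction_on with
      | _ i ih =>
        intro hi
        rcases i with _ | _ | i
        · exact ⟨by omega, by simp⟩
        · exact ⟨by omega, h1⟩
        · obtain ⟨a1, a2⟩ := ih (i + 1) (by omega) (by omega)
          obtain ⟨b1, b2⟩ := ih i (by omega) (by omega)
          have he := hPe (i + 1) (by omega)
          have hadj := Walk.adj_of_mem_edges c he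
          have hmem := (hds _).2 (Walk.snd_mem_support_of_mem_edges c he)
          obtain ⟨k, hk, hkl⟩ := Walk.mem_support_iff_exists_getVert.1 hmem
          obtain ⟨k, hk, hkl⟩ : ∃ k, d.getVert k = P.getVert (i + 1 + 1) ∧ k < c.length := by
            by_cases h : k = d.length
            · exact ⟨0, by rw [← hk, h]; simp, by omega⟩
            · exact ⟨k, hk, by omega⟩
          have hki : k ≠ i := by
            rintro rfl
            have := hPinj k (k + 1 + 1) (by omega) hi (by rw [b2, hk])
            omega
          have hk0 : k ≠ 0 := by
            rintro rfl
            have := hPinj 0 (i + 1 + 1) (by omega) hi (by rw [← hk]; simp)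
            omega
          rw [← hk, a2] at hadj
          rcases Nat.lt_trichotomy (i + 1) k with h | h | h
          · have := (hdc _ _ h (by omega)).2.1 hadj
            have e : k = i + 1 + 1 := by omega
            exact ⟨by omega, by rw [← e, hk, e]⟩
          · rw [h] at hadj
            exact absurd hadj (SimpleGraph.irrefl _)
          · have := (hdc _ _ h (by omega)).2.1 hadj.symm
            omega
    refine ⟨_, hcyc, fun i => by simp, ?_, (hlist _ le_rfl).1, fun i hi => ?_⟩
    · intro z
      rw [← hds, Walk.mem_support_iff_exists_getVert]
      constructor
      · rintro ⟨k, rfl, hk⟩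
        by_cases h : k = d.length
        · refine ⟨0, by omega, ?_⟩
          rw [h]; simp
        · refine ⟨k, by omega, ?_⟩
          rw [hmod k (by omega)]
      · rintro ⟨k, hk, rfl⟩
        exact ⟨k, (hmod k hk).symm, by omega⟩
    · rw [hmod i (hlist i hi).1, (hlist i hi).2]
  classical
  have hd : (c.rotate p₁ hp₁).IsCycle := (Walk.isCycle_rotate hp₁).2 hc.1
  have hde : ∀ e, e ∈ (c.rotate p₁ hp₁).edges ↔ e ∈ c.edges := fun e =>
    (c.rotate_edges p₁ hp₁).mem_iff
  have hds : ∀ z, z ∈ (c.rotate p₁ hp₁).support ↔ z ∈ c.support := fun z =>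
    Walk.mem_support_rotate_iff ..
  have hdl : (c.rotate p₁ hp₁).length = c.length := by simp
  generalize c.rotate p₁ hp₁ = d at hd hde hds hdl
  have hdc := hd.icyc (fun x hx y hy h => (hde _).2 (hc.2.2 x ((hds x).1 hx) y ((hds y).1 hy) h))
  have hn := hc.2.1
  have he := hPe 0 (by omega)
  have hadj : G.Adj p₁ (P.getVert 1) := by simpa using Walk.adj_of_mem_edges c he
  have hmem := (hds _).2 (Walk.snd_mem_support_of_mem_edges c he)
  obtain ⟨k, hk, hkl⟩ := Walk.mem_support_iff_exists_getVert.1 hmem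
  rw [zero_add] at hk
  have hk0 : k ≠ 0 := by
    rintro rfl
    rw [← hk] at hadj
    simp at hadj
  have hkn : k ≠ d.length := by
    rintro rfl
    rw [← hk] at hadj
    simp at hadj
  replace hadj : G.Adj (d.getVert 0) (d.getVert k) := by rw [hk]; simpa using hadj
  rcases (hdc 0 k (by omega) (by omega)).2.1 hadj with h | h
  · subst h
    exact main d hd hde hds hdl hk.symm
  · refine main d.reverse hd.reverse (by simpa using hde) (by simpa using hds) (by simpa using hdl) ?_
    rw [Walk.getVert_reverse, ← hk]
    congr 1; omega

end LEH

/-- the possible attachments of a `C`-major vertex `y` in a long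
`(C,x)`-gap `P`. -/
theorem twoingap {V : Type*} [Fintype V]
    (ℓ : ℕ) (hℓ : 6 ≤ ℓ) (hℓeven : Even ℓ)
    (G : SimpleGraph V) (hG : Candidate G ℓ)
    {u : V} (c : G.Walk u u) (hc : ShortestLEH G ℓ c)
    (x y : V) (hx : CMajor G c x) (hy : CMajor G c y) (hxy : ¬ G.Adj x y)
    {p₁ p₂ : V} (P : G.Walk p₁ p₂) (hP : IsGap G c x P)
    (hPlen : ℓ - 2 ≤ P.length)
    (hynbr : ∃ v ∈ P.support, G.Adj y v) :
    (∃ v ∈ P.support, G.Adj y v ∧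
        (listIdx P.support v ≤ ℓ - 5 ∨ listIdx P.support.reverse v ≤ ℓ - 5)) ∨
    (∃ z, (s(p₁, z) ∈ c.edges ∨ s(p₂, z) ∈ c.edges) ∧ G.Adj y z) ∨
    (∃ v w, v ∈ P.support ∧ w ∈ P.support ∧ v ≠ w ∧ G.Adj y v ∧ G.Adj y w ∧
        G.Adj v w ∧ ∀ z ∈ P.support, G.Adj y z → z = v ∨ z = w) := by
  obtain ⟨⟨⟨-, hJ, hT, -⟩, hN⟩, ⟨hole, hcl, hce⟩, hmin⟩ := And.intro hG hc
  obtain ⟨hPp, hPc, hP2, hx₁, hx₂, hxint⟩ := hP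
  obtain ⟨f, hf, hper, hsup, hPn, hPf⟩ := hole.exists_listing hPp hPc (by omega)
  have hmaj : ∀ z, CMajor G c z → Major G c.length f z := by
    rintro z ⟨h1, h2⟩
    have hmod : ∀ i, f (i % c.length) = f i := fun i => by
      conv_rhs => rw [← Nat.mod_add_div i c.length]
      induction i / c.length with
      | zero => simp
      | succ k ih => rw [Nat.mul_succ, ← Nat.add_assoc, hper, ← ih]
    refine ⟨?_, ?_⟩
    · rintro i rfl
      exact h1 ((hsup _).2 ⟨i % c.length, Nat.mod_lt _ (by omega), (hmod i).symm⟩)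
    · intro m hm
      by_contra hcon
      push Not at hcon
      refine h2 ⟨f m, (hsup _).2 ⟨m, hm, rfl⟩, fun w hw hzw => ?_⟩
      obtain ⟨i, hi, rfl⟩ := (hsup w).1 hw
      by_cases him : i = m
      · exact Or.inl (by rw [him])
      · exact Or.inr (hole.2.2 _ ((hsup _).2 ⟨m, hm, rfl⟩) _ hw (hcon i hi hzw him))
  have H : MinCyc G ℓ c.length f := by
    refine ⟨hf, hper, hce, hcl, fun k g hg hk hke => ?_⟩
    obtain ⟨v, c', h1, h2, -⟩ := hg.hole (by omega)
    rw [← h2]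
    exact hmin v c' ⟨h1, by omega, by rwa [h2]⟩
  have hf0 : f 0 = p₁ := by rw [← hPf 0 (by omega)]; simp
  have hfp : f P.length = p₂ := by rw [← hPf _ le_rfl]; simp
  have hPs : ∀ z, z ∈ P.support ↔ ∃ i ≤ P.length, z = f i := by
    intro z
    rw [Walk.mem_support_iff_exists_getVert]
    constructor
    · rintro ⟨i, rfl, hi⟩
      exact ⟨i, hi, hPf i hi⟩
    · rintro ⟨i, hi, rfl⟩
      exact ⟨i, hPf i hi, hi⟩
  have hedge : ∀ i j, i < c.length → j < c.length → G.Adj (f i) (f j) → s(f i, f j) ∈ c.edges :=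
    fun i j hi hj h => hole.2.2 _ ((hsup _).2 ⟨i, hi, rfl⟩) _ ((hsup _).2 ⟨j, hj, rfl⟩) h
  have hgap : ∀ i, 0 < i → i < P.length → ¬ G.Adj x (f i) := fun i hi hi' =>
    hxint _ ⟨(hPs _).2 ⟨i, hi'.le, rfl⟩, by
      rw [← hf0]; exact (hf 0 i hi (by omega)).1.symm, by
      rw [← hfp]; exact (hf i _ hi' hPn).1⟩
  by_contra hcon
  rw [not_or, not_or] at hcon
  obtain ⟨c₁, c₂, c₃⟩ := hcon
  have hn4 := hole.2.1
  obtain ⟨-, hpn, -⟩ := H.long_gap hℓ hJ hT hN (hmaj x hx) hPn (by omega) (by rwa [hf0])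
    (by rwa [hfp]) hgap
  obtain ⟨a, ha, hya, hya', hu⟩ := H.attachment hℓ hJ hT hN (hmaj x hx) (hmaj y hy) hxy hPn
    (by omega) (by rwa [hf0])
    (by rwa [hfp]) hgap
    (fun i hi h => by
      have h1 := listIdx_support_getVert_le P hi
      have h2 := listIdx_support_getVert_le P.reverse (i := P.length - i) (by simp)
      rw [Walk.support_reverse, Walk.getVert_reverse, Nat.sub_sub_self hi] at h2
      rw [hPf i hi] at h1 h2
      by_contra hlt
      exact c₁ ⟨f i, (hPs _).2 ⟨i, hi, rfl⟩, h, by omega⟩)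
    (fun h => c₂ ⟨_, Or.inl (by
      rw [← hf0]
      refine hedge 0 _ (by omega) (by omega) ?_
      rw [(hf 0 (c.length - 1) (by omega) (by omega)).2]
      omega), h⟩)
    (fun h => c₂ ⟨_, Or.inr (by
      have he := hedge P.length (P.length + 1) (by omega) (by omega)
        ((hf _ (P.length + 1) (by omega) (by omega)).2.2 (Or.inl rfl))
      rwa [hfp] at he), h⟩)
    (by
      obtain ⟨v, hv, h⟩ := hynbr
      obtain ⟨i, hi, rfl⟩ := (hPs v).1 hv
      exact ⟨i, hi, h⟩)
  have hfa := hf a (a + 1) (by omega) (by omega)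
  refine c₃ ⟨f a, f (a + 1), (hPs _).2 ⟨a, by omega, rfl⟩, (hPs _).2 ⟨a + 1, ha, rfl⟩, hfa.1,
    hya, hya', hfa.2.2 (Or.inl rfl), fun z hz h => ?_⟩
  obtain ⟨i, hi, rfl⟩ := (hPs z).1 hz
  rcases hu i hi h with rfl | rfl
  exacts [Or.inl rfl, Or.inr rfl]
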